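/- For every even N ≥ 0, E_{μ_N}[a²] = N(3N³+10N²+9N−10)/192, and for every odd N ≥ 1, E_{μ_N}[b²] = (N−1)(3N³+13N²+10N−12)/192. -/

import Mathlib

/-- The image of the delta measure at `p` under the Demazure operator `D₀`, acting in the
coordinates `λ = Λ₀ - a·α₀ - b·α₁`: `D₀ δ_{(a,b)} = ∑_{i=0}^{1-2a+2b} δ_{(a+i,b)}`, with the
signed-sum convention `∑_{i=0}^{-1} = 0` and `∑_{i=0}^{n} = -∑_{i=n+1}^{-1}` for `n ≤ -2`. -/
noncomputable def elemD0 (p : ℤ × ℤ) : (ℤ × ℤ) →₀ ℤ :=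
  (∑ i ∈ Finset.Icc (0 : ℤ) (1 - 2 * p.1 + 2 * p.2), Finsupp.single (p.1 + i, p.2) (1 : ℤ))
  - (∑ i ∈ Finset.Icc (1 - 2 * p.1 + 2 * p.2 + 1) (-1 : ℤ), Finsupp.single (p.1 + i, p.2) (1 : ℤ))

/-- The image of the delta measure at `p` under the Demazure operator `D₁`:
`D₁ δ_{(a,b)} = ∑_{i=0}^{2a-2b} δ_{(a,b+i)}`, with the signed-sum convention. -/
noncomputable def elemD1 (p : ℤ × ℤ) : (ℤ × ℤ) →₀ ℤ :=
  (∑ i ∈ Finset.Icc (0 : ℤ) (2 * p.1 - 2 * p.2), Finsupp.single (p.1, p.2 + i) (1 : ℤ))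
  - (∑ i ∈ Finset.Icc (2 * p.1 - 2 * p.2 + 1) (-1 : ℤ), Finsupp.single (p.1, p.2 + i) (1 : ℤ))

/-- The Demazure operator `D₀` on finitely supported functions `ℤ × ℤ → ℤ`. -/
noncomputable def demD0 (mu : (ℤ × ℤ) →₀ ℤ) : (ℤ × ℤ) →₀ ℤ :=
  mu.sum fun p c => c • elemD0 p

/-- The Demazure operator `D₁` on finitely supported functions `ℤ × ℤ → ℤ`. -/
noncomputable def demD1 (mu : (ℤ × ℤ) →₀ ℤ) : (ℤ × ℤ) →₀ ℤ :=
  mu.sum fun p c => c • elemD1 p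

/-- The weight distribution `μ_N` of the Demazure module `V_{w_N}(Λ₀)` of affine sl₂,
where a weight is written `λ = Λ₀ - a·α₀ - b·α₁`:  `μ₀ = δ_{(0,0)}`,
`μ_{N+1} = D₀ μ_N` for even `N` and `μ_{N+1} = D₁ μ_N` for odd `N`. -/
noncomputable def demMu : ℕ → (ℤ × ℤ) →₀ ℤ
  | 0 => Finsupp.single (0, 0) 1
  | (N + 1) => if Even N then demD0 (demMu N) else demD1 (demMu N)

/-- Total mass `∑_{(a,b)} μ(a,b)` of a finitely supported signed measure, in `ℚ`. -/
noncomputable def totalMass (mu : (ℤ × ℤ) →₀ ℤ) : ℚ :=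
  mu.sum fun _ c => (c : ℚ)

/-- Expected value of `f` with respect to `μ`. -/
noncomputable def expVal (mu : (ℤ × ℤ) →₀ ℤ) (f : ℤ × ℤ → ℚ) : ℚ :=
  (mu.sum fun p c => (c : ℚ) * f p) / totalMass mu

/-- Covariance of `f` and `g` with respect to `μ`. -/
noncomputable def covar (mu : (ℤ × ℤ) →₀ ℤ) (f g : ℤ × ℤ → ℚ) : ℚ :=
  expVal mu (fun p => f p * g p) - expVal mu f * expVal mu g

/-- Variance of `f` with respect to `μ`. -/
noncomputable def var (mu : (ℤ × ℤ) →₀ ℤ) (f : ℤ × ℤ → ℚ) : ℚ :=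
  covar mu f f

/-- The sum of `F k i` over all binary words of length `N`, where `k` is the number of ones and
`i` the number of inversions of the word. -/
def wordSum : ℕ → (ℤ → ℤ → ℚ) → ℚ
  | 0, F => F 0 0
  | N + 1, F => wordSum N fun k i => F (k + 1) i + F k (i + k)

theorem wordSum_add (N : ℕ) (F G : ℤ → ℤ → ℚ) :
    wordSum N (fun k i => F k i + G k i) = wordSum N F + wordSum N G := by
  induction N generalizing F G with
  | zero => rfl
  | succ N ih =>
    simp only [wordSum, ih]
    ring

theorem wordSum_mul_left (N : ℕ) (c : ℚ) (F : ℤ → ℤ → ℚ) :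
    wordSum N (fun k i => c * F k i) = c * wordSum N F := by
  induction N generalizing F with
  | zero => rfl
  | succ N ih => simp only [wordSum, ← mul_add, ih]

theorem wordSum_sub (N : ℕ) (F G : ℤ → ℤ → ℚ) :
    wordSum N (fun k i => F k i - G k i) = wordSum N F - wordSum N G := by
  have h := wordSum_add N F fun k i => -1 * G k i
  rw [wordSum_mul_left] at h
  simpa [← sub_eq_add_neg] using h

/-- The Pascal recursion obtained by prepending a letter, dual to the one defining `wordSum`. -/
theorem wordSum_succ' (N : ℕ) (F : ℤ → ℤ → ℚ) :
    wordSum (N + 1) F = wordSum N fun k i => F k i + F (k + 1) (i + N - k) := by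
  induction N generalizing F with
  | zero => simp [wordSum, add_comm]
  | succ N ih =>
    rw [wordSum, ih, wordSum]
    congr 1
    funext k i
    have h₁ : i + N - k + (k + 1) = i + k + ((N + 1 : ℕ) : ℤ) - k := by push_cast; ring
    have h₂ : i + ((N + 1 : ℕ) : ℤ) - (k + 1) = i + N - k := by push_cast; ring
    rw [h₁, h₂]
    ring

theorem wordSum_reflect (N : ℕ) (F : ℤ → ℤ → ℚ) :
    wordSum N (fun k i => F (N - k) i) = wordSum N F := by
  induction N generalizing F with
  | zero => simp [wordSum]
  | succ N ih =>
    rw [wordSum_succ' N F, wordSum, ← ih]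
    congr 1
    funext k i
    congr 2 <;> push_cast <;> ring

/-- Summing `G (k + 1) i - G k i` over words of length `N + 1` telescopes along strings indexed by
the words of length `N`. -/
theorem wordSum_succ_diff (N : ℕ) (G : ℤ → ℤ → ℚ) :
    wordSum (N + 1) (fun k i => G (k + 1) i - G k i) =
      wordSum N fun k i => G (N + 2 - k) (i + k) - G k (i + k) := by
  have h₁ : wordSum (N + 1) (fun k i => G (k + 1) i) =
      wordSum N (fun k i => G (N + 2 - k) (i + k)) + wordSum N (fun k i => G (k + 1) i) := by
    rw [← wordSum_reflect, wordSum, wordSum_add, add_comm]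
    congr 1
    · congr 1
      funext k i
      congr 1
      push_cast
      ring
    · rw [← wordSum_reflect N fun k i => G (k + 1) i]
      congr 1
      funext k i
      congr 1
      push_cast
      ring
  have h₂ : wordSum (N + 1) G =
      wordSum N (fun k i => G (k + 1) i) + wordSum N (fun k i => G k (i + k)) := by
    rw [wordSum, wordSum_add]
  rw [wordSum_sub, wordSum_sub, h₁, h₂]
  ring

theorem exists_antidifference (F : ℤ → ℚ) : ∃ G : ℤ → ℚ, ∀ x, G (x + 1) - G x = F x := by
  refine ⟨fun x => ∑ i ∈ Finset.range x.toNat, F i -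
    ∑ i ∈ Finset.range (-x).toNat, F (-1 - i), fun x => ?_⟩
  obtain ⟨n, rfl | rfl⟩ := x.eq_nat_or_neg
  · have h₁ : ((n : ℤ) + 1).toNat = n + 1 := by omega
    have h₂ : (-((n : ℤ) + 1)).toNat = 0 := by omega
    have h₃ : (-(n : ℤ)).toNat = 0 := by omega
    simp only [h₁, h₂, h₃, Int.toNat_natCast, Finset.sum_range_succ, Finset.sum_range_zero]
    ring
  · cases n with
    | zero => simp
    | succ n =>
      have h₁ : (-((n + 1 : ℕ) : ℤ) + 1).toNat = 0 := by omega
      have h₂ : (-(-((n + 1 : ℕ) : ℤ) + 1)).toNat = n := by omega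
      have h₃ : (-((n + 1 : ℕ) : ℤ)).toNat = 0 := by omega
      have h₄ : (- -((n + 1 : ℕ) : ℤ)).toNat = n + 1 := by omega
      have h₅ : -((n + 1 : ℕ) : ℤ) = -1 - n := by push_cast; ring
      simp only [h₁, h₂, h₃, h₄, Finset.sum_range_succ]
      rw [h₅]
      simp

theorem exists_antidifference_left (F : ℤ → ℤ → ℚ) :
    ∃ G : ℤ → ℤ → ℚ, ∀ x i, G (x + 1) i - G x i = F x i := by
  choose G hG using fun i => exists_antidifference fun x => F x i
  exact ⟨fun x i => G i x, fun x i => hG i x⟩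

theorem sum_Icc_int_diff (H : ℤ → ℚ) (a : ℤ) (n : ℕ) :
    ∑ i ∈ Finset.Icc a (a + n - 1), (H (i + 1) - H i) = H (a + n) - H a := by
  induction n with
  | zero => simp
  | succ n ih =>
    have h : Finset.Icc a (a + (n + 1 : ℕ) - 1) = insert (a + n) (Finset.Icc a (a + n - 1)) := by
      ext x
      simp only [Finset.mem_Icc, Finset.mem_insert]
      omega
    rw [h, Finset.sum_insert (by simp), ih]
    push_cast
    ring_nf

theorem signed_sum_diff (H : ℤ → ℚ) (n : ℤ) :
    ∑ i ∈ Finset.Icc 0 n, (H (i + 1) - H i) - ∑ i ∈ Finset.Icc (n + 1) (-1), (H (i + 1) - H i) =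
      H (n + 1) - H 0 := by
  rcases le_total (n + 1) 0 with h | h
  · obtain ⟨m, hm⟩ := Int.eq_ofNat_of_zero_le (neg_nonneg.2 h)
    have key := sum_Icc_int_diff H (n + 1) m
    have h₁ : n + 1 + (m : ℤ) = 0 := by omega
    rw [h₁, zero_sub] at key
    rw [key, Finset.Icc_eq_empty (by omega)]
    simp
  · obtain ⟨m, hm⟩ := Int.eq_ofNat_of_zero_le h
    have key := sum_Icc_int_diff H 0 m
    rw [← hm, zero_add, add_sub_cancel_right] at key
    rw [key, Finset.Icc_eq_empty (a := n + 1) (by omega)]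
    simp

/-- The integral of `f` against a finitely supported signed measure. -/
noncomputable def pairing (f : ℤ × ℤ → ℚ) : ((ℤ × ℤ) →₀ ℤ) →+ ℚ :=
  Finsupp.liftAddHom fun p => (AddMonoidHom.mulRight (f p)).comp (Int.castAddHom ℚ)

theorem pairing_apply (f : ℤ × ℤ → ℚ) (mu : (ℤ × ℤ) →₀ ℤ) :
    pairing f mu = mu.sum fun p c => (c : ℚ) * f p := rfl

theorem pairing_single (f : ℤ × ℤ → ℚ) (p : ℤ × ℤ) (c : ℤ) :
    pairing f (Finsupp.single p c) = c * f p := by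
  simp [pairing]

theorem pairing_sum_smul (f : ℤ × ℤ → ℚ) (mu : (ℤ × ℤ) →₀ ℤ) (T : ℤ × ℤ → (ℤ × ℤ) →₀ ℤ) :
    pairing f (mu.sum fun p c => c • T p) = pairing (fun p => pairing f (T p)) mu := by
  rw [map_finsuppSum, pairing_apply]
  simp only [map_zsmul, zsmul_eq_mul]

theorem pairing_demD0 (f : ℤ × ℤ → ℚ) (G : ℤ → ℤ → ℚ)
    (hG : ∀ a b, G (a + 1) b - G a b = f (a, b)) (mu : (ℤ × ℤ) →₀ ℤ) :
    pairing f (demD0 mu) = pairing (fun p => G (2 - p.1 + 2 * p.2) p.2 - G p.1 p.2) mu := by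
  rw [demD0, pairing_sum_smul]
  congr 2
  funext ⟨a, b⟩
  have key := signed_sum_diff (fun i => G (a + i) b) (1 - 2 * a + 2 * b)
  simp only [elemD0, map_sub, map_sum, pairing_single, Int.cast_one, one_mul, ← hG]
  simp only [← add_assoc, add_zero] at key
  rw [key]
  ring_nf

theorem pairing_demD1 (f : ℤ × ℤ → ℚ) (G : ℤ → ℤ → ℚ)
    (hG : ∀ a b, G a (b + 1) - G a b = f (a, b)) (mu : (ℤ × ℤ) →₀ ℤ) :
    pairing f (demD1 mu) = pairing (fun p => G p.1 (2 * p.1 - p.2 + 1) - G p.1 p.2) mu := by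
  rw [demD1, pairing_sum_smul]
  congr 2
  funext ⟨a, b⟩
  have key := signed_sum_diff (fun i => G a (b + i)) (2 * a - 2 * b)
  simp only [elemD1, map_sub, map_sum, pairing_single, Int.cast_one, one_mul, ← hG]
  simp only [← add_assoc, add_zero] at key
  rw [key]
  ring_nf

theorem pairing_demMu_odd_of_even {m : ℕ}
    (h : ∀ f, pairing f (demMu (2 * m)) =
      wordSum (2 * m) fun k i => f ((m : ℤ) ^ 2 - i, (m : ℤ) ^ 2 - i - k + m))
    (f : ℤ × ℤ → ℚ) :
    pairing f (demMu (2 * m + 1)) =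
      wordSum (2 * m + 1) fun k i => f ((m : ℤ) ^ 2 + k - i, (m : ℤ) ^ 2 + m - i) := by
  obtain ⟨G, hG⟩ := exists_antidifference_left fun a b => f (a, b)
  have hk := wordSum_succ_diff (2 * m)
    fun k i => G ((m : ℤ) ^ 2 + k - i) ((m : ℤ) ^ 2 + m - i)
  have h₁ : ∀ k i : ℤ, G ((m : ℤ) ^ 2 + (k + 1) - i) ((m : ℤ) ^ 2 + m - i) -
      G ((m : ℤ) ^ 2 + k - i) ((m : ℤ) ^ 2 + m - i) =
      f ((m : ℤ) ^ 2 + k - i, (m : ℤ) ^ 2 + m - i) := fun k i => by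
    rw [← hG]
    ring_nf
  simp only [h₁] at hk
  rw [demMu, if_pos (even_two_mul m), pairing_demD0 f G hG, h, hk]
  congr 1
  funext k i
  push_cast
  ring_nf

theorem pairing_demMu_even_of_odd {m : ℕ}
    (h : ∀ f, pairing f (demMu (2 * m + 1)) =
      wordSum (2 * m + 1) fun k i => f ((m : ℤ) ^ 2 + k - i, (m : ℤ) ^ 2 + m - i))
    (f : ℤ × ℤ → ℚ) :
    pairing f (demMu (2 * m + 2)) =
      wordSum (2 * m + 2) fun k i =>
        f (((m + 1 : ℕ) : ℤ) ^ 2 - i, ((m + 1 : ℕ) : ℤ) ^ 2 - i - k + (m + 1 : ℕ)) := by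
  obtain ⟨G, hG⟩ := exists_antidifference_left fun b a => f (a, b)
  have hk := wordSum_succ_diff (2 * m + 1) fun k i =>
    -G ((m + 1 : ℤ) ^ 2 - i - k + m + 2) ((m + 1 : ℤ) ^ 2 - i)
  have h₁ : ∀ k i : ℤ, -G ((m + 1 : ℤ) ^ 2 - i - (k + 1) + m + 2) ((m + 1 : ℤ) ^ 2 - i) -
      -G ((m + 1 : ℤ) ^ 2 - i - k + m + 2) ((m + 1 : ℤ) ^ 2 - i) =
      f (((m + 1 : ℕ) : ℤ) ^ 2 - i, ((m + 1 : ℕ) : ℤ) ^ 2 - i - k + (m + 1 : ℕ)) := fun k i => by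
    rw [← hG]
    push_cast
    ring_nf
  simp only [h₁] at hk
  rw [demMu, if_neg (by simp), pairing_demD1 f (fun a b => G b a) (fun a b => hG b a), h, hk,
    ← wordSum_reflect]
  congr 1
  funext k i
  push_cast
  ring_nf

/-- The Demazure weight distribution as the distribution of a statistic on binary words. -/
theorem pairing_demMu_even (m : ℕ) (f : ℤ × ℤ → ℚ) :
    pairing f (demMu (2 * m)) =
      wordSum (2 * m) fun k i => f ((m : ℤ) ^ 2 - i, (m : ℤ) ^ 2 - i - k + m) := by
  induction m generalizing f with
  | zero => simp [demMu, pairing_single, wordSum]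
  | succ m ih => exact pairing_demMu_even_of_odd (pairing_demMu_odd_of_even ih) f

theorem pairing_demMu_odd (m : ℕ) (f : ℤ × ℤ → ℚ) :
    pairing f (demMu (2 * m + 1)) =
      wordSum (2 * m + 1) fun k i => f ((m : ℤ) ^ 2 + k - i, (m : ℤ) ^ 2 + m - i) :=
  pairing_demMu_odd_of_even (pairing_demMu_even m) f

theorem wordSum_const (N : ℕ) (c : ℚ) : wordSum N (fun _ _ => c) = 2 ^ N * c := by
  induction N generalizing c with
  | zero => simp [wordSum]
  | succ N ih =>
    rw [wordSum, ih]
    ring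

theorem wordSum_ones (N : ℕ) : wordSum N (fun k _ => (k : ℚ)) = 2 ^ N * (N / 2) := by
  induction N with
  | zero => simp [wordSum]
  | succ N ih =>
    have h : wordSum (N + 1) (fun k _ => (k : ℚ)) = wordSum N fun k _ => 2 * (k : ℚ) + 1 := by
      rw [wordSum]
      congr 1
      funext k i
      push_cast
      ring
    rw [h, wordSum_add, wordSum_mul_left, ih, wordSum_const]
    push_cast
    ring

theorem wordSum_ones_sq (N : ℕ) :
    wordSum N (fun k _ => (k : ℚ) ^ 2) = 2 ^ N * (N * (N + 1) / 4) := by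
  induction N with
  | zero => simp [wordSum]
  | succ N ih =>
    have h : wordSum (N + 1) (fun k _ => (k : ℚ) ^ 2) =
        wordSum N fun k _ => 2 * (k : ℚ) ^ 2 + (2 * (k : ℚ) + 1) := by
      rw [wordSum]
      congr 1
      funext k i
      push_cast
      ring
    rw [h, wordSum_add, wordSum_add, wordSum_mul_left, wordSum_mul_left, ih, wordSum_ones,
      wordSum_const]
    push_cast
    ring

theorem wordSum_inv (N : ℕ) :
    wordSum N (fun _ i => (i : ℚ)) = 2 ^ N * (N * (N - 1) / 8) := by
  induction N with
  | zero => simp [wordSum]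
  | succ N ih =>
    have h : wordSum (N + 1) (fun _ i => (i : ℚ)) =
        wordSum N fun k i => 2 * (i : ℚ) + (k : ℚ) := by
      rw [wordSum]
      congr 1
      funext k i
      push_cast
      ring
    rw [h, wordSum_add, wordSum_mul_left, ih, wordSum_ones]
    push_cast
    ring

theorem wordSum_inv_mul_ones (N : ℕ) :
    wordSum N (fun k i => (i : ℚ) * k) = 2 ^ N * (N ^ 2 * (N - 1) / 16) := by
  induction N with
  | zero => simp [wordSum]
  | succ N ih =>
    have h : wordSum (N + 1) (fun k i => (i : ℚ) * k) =
        wordSum N fun k i => 2 * ((i : ℚ) * k) + ((i : ℚ) + (k : ℚ) ^ 2) := by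
      rw [wordSum]
      congr 1
      funext k i
      push_cast
      ring
    rw [h, wordSum_add, wordSum_add, wordSum_mul_left, ih, wordSum_inv, wordSum_ones_sq]
    push_cast
    ring

theorem wordSum_inv_sq (N : ℕ) :
    wordSum N (fun _ i => (i : ℚ) ^ 2) =
      2 ^ N * (N * (3 * N ^ 3 - 2 * N ^ 2 + 9 * N - 10) / 192) := by
  induction N with
  | zero => simp [wordSum]
  | succ N ih =>
    have h : wordSum (N + 1) (fun _ i => (i : ℚ) ^ 2) =
        wordSum N fun k i => 2 * (i : ℚ) ^ 2 + (2 * ((i : ℚ) * k) + (k : ℚ) ^ 2) := by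
      rw [wordSum]
      congr 1
      funext k i
      push_cast
      ring
    rw [h, wordSum_add, wordSum_add, wordSum_mul_left, wordSum_mul_left, ih,
      wordSum_inv_mul_ones, wordSum_ones_sq]
    push_cast
    ring

theorem wordSum_const_sub_inv_sq (N : ℕ) (c : ℚ) :
    wordSum N (fun _ i => (c - i) ^ 2) =
      2 ^ N * (c ^ 2 - 2 * c * (N * (N - 1) / 8) +
        N * (3 * N ^ 3 - 2 * N ^ 2 + 9 * N - 10) / 192) := by
  have h : (fun _ i : ℤ => (c - (i : ℚ)) ^ 2) =
      fun _ i : ℤ => (i : ℚ) ^ 2 + (-(2 * c) * (i : ℚ) + c ^ 2) := by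
    funext k i
    ring
  rw [h, wordSum_add, wordSum_add, wordSum_mul_left, wordSum_inv_sq, wordSum_inv, wordSum_const]
  ring

theorem totalMass_eq_pairing (mu : (ℤ × ℤ) →₀ ℤ) : totalMass mu = pairing (fun _ => 1) mu := by
  simp [totalMass, pairing_apply]

theorem totalMass_demMu (N : ℕ) : totalMass (demMu N) = 2 ^ N := by
  rw [totalMass_eq_pairing]
  obtain ⟨m, rfl | rfl⟩ := N.even_or_odd'
  · rw [pairing_demMu_even, wordSum_const, mul_one]
  · rw [pairing_demMu_odd, wordSum_const, mul_one]

theorem expVal_demMu (N : ℕ) (f : ℤ × ℤ → ℚ) :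
    expVal (demMu N) f = pairing f (demMu N) / 2 ^ N := by
  rw [expVal, totalMass_demMu, pairing_apply]

/-- For even `N`, `E_{μ_N}[a²] = N(3N³+10N²+9N-10)/192`, and for odd `N`,
`E_{μ_N}[b²] = (N-1)(3N³+13N²+10N-12)/192`. -/
theorem second_moments (N : ℕ) :
    (Even N →
      expVal (demMu N) (fun p => (p.1 : ℚ) ^ 2) =
        (N : ℚ) * (3 * (N : ℚ) ^ 3 + 10 * (N : ℚ) ^ 2 + 9 * (N : ℚ) - 10) / 192) ∧
    (Odd N →
      expVal (demMu N) (fun p => (p.2 : ℚ) ^ 2) =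
        ((N : ℚ) - 1) * (3 * (N : ℚ) ^ 3 + 13 * (N : ℚ) ^ 2 + 10 * (N : ℚ) - 12) / 192) := by
  have hpow : (2 : ℚ) ^ N ≠ 0 := by positivity
  rw [expVal_demMu, expVal_demMu]
  constructor
  · intro hN
    obtain ⟨m, rfl⟩ := hN.exists_two_nsmul
    rw [smul_eq_mul] at hpow ⊢
    have h := wordSum_const_sub_inv_sq (2 * m) ((m : ℚ) ^ 2)
    rw [pairing_demMu_even]
    push_cast at h ⊢
    rw [h, mul_div_cancel_left₀ _ hpow]
    ring
  · rintro ⟨m, rfl⟩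
    have h := wordSum_const_sub_inv_sq (2 * m + 1) ((m : ℚ) ^ 2 + m)
    rw [pairing_demMu_odd]
    push_cast at h ⊢
    rw [h, mul_div_cancel_left₀ _ hpow]
    ring
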